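/- arXiv:2605.20491 — 2 statements merged into one kernel-verified Lean document; each statement's English description precedes it below -/
import Mathlib

section
/- Let H be a complex Hilbert space, let K : H → H be a compact self-adjoint bounded linear operator, and let ε > 0. Then there exists a natural number M (depending only on K and ε) such that for EVERY orthogonal projection P on H, the subspace of H spanned by all eigenvectors of the operator P ∘ K ∘ P corresponding to eigenvalues μ ∈ ℝ with |μ| ≥ ε is finite-dimensional with dimension at most M. -/
open ContinuousLinearMap

section

variable {H : Type*} [NormedAddCommGroup H] [InnerProductSpace ℂ H]

/-- A symmetric operator is bounded below by `ε` on the sum of its eigenspaces for eigenvalues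
of modulus at least `ε`. -/
theorem LinearMap.IsSymmetric.mul_norm_le_norm_of_mem_iSup_eigenspace {T : H →ₗ[ℂ] H}
    (hT : T.IsSymmetric) {ε : ℝ} (hε : 0 ≤ ε) {x : H}
    (hx : x ∈ ⨆ μ : {μ : ℂ // ε ≤ ‖μ‖}, Module.End.eigenspace T μ) : ε * ‖x‖ ≤ ‖T x‖ := by
  obtain ⟨f, hf, rfl⟩ := (Submodule.mem_iSup_iff_exists_finsupp _ _).1 hx
  have hO : OrthogonalFamily ℂ
      (fun μ : {μ : ℂ // ε ≤ ‖μ‖} => Module.End.eigenspace T (μ : ℂ)) fun μ =>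
        (Module.End.eigenspace T (μ : ℂ)).subtypeₗᵢ :=
    hT.orthogonalFamily_eigenspaces.comp Subtype.val_injective
  let l : ∀ μ : {μ : ℂ // ε ≤ ‖μ‖}, Module.End.eigenspace T (μ : ℂ) := fun μ => ⟨f μ, hf μ⟩
  have h1 : ‖f.sum fun _ y => y‖ ^ 2 = ∑ μ ∈ f.support, ‖f μ‖ ^ 2 := hO.norm_sum l f.support
  have h2 : ‖T (f.sum fun _ y => y)‖ ^ 2 = ∑ μ ∈ f.support, ‖(μ : ℂ) • f μ‖ ^ 2 := by
    rw [Finsupp.sum, map_sum,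
      Finset.sum_congr rfl fun μ _ => Module.End.mem_eigenspace_iff.1 (hf μ)]
    exact hO.norm_sum (fun μ => (μ : ℂ) • l μ) f.support
  refine le_of_sq_le_sq ?_ (norm_nonneg _)
  rw [mul_pow, h1, h2, Finset.mul_sum]
  refine Finset.sum_le_sum fun μ _ => ?_
  rw [norm_smul, mul_pow]
  gcongr
  exact μ.2

/-- For a compact operator `K`, the subspaces on which `K` is bounded below by `ε` have
uniformly bounded dimension. -/
theorem IsCompactOperator.exists_rank_le {K : H →L[ℂ] H} (hK : IsCompactOperator K)
    {ε : ℝ} (hε : 0 < ε) :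
    ∃ M : ℕ, ∀ S : Submodule ℂ H, (∀ x ∈ S, ε * ‖x‖ ≤ ‖K x‖) → Module.rank ℂ S ≤ M := by
  obtain ⟨t, -, ht, hcov⟩ := exists_finite_cover_balls_of_isCompact_closure
    (IsCompactOperator.isCompact_closure_image_closedBall (f := K.toLinearMap) hK 1) (half_pos hε)
  refine ⟨ht.toFinset.card, fun S hS => rank_le fun s hs => ?_⟩
  by_contra! hlt
  let V := Submodule.span ℂ (s : Set S)
  have hV : Module.finrank ℂ V = s.card := finrank_span_finset_eq_card hs
  let b := stdOrthonormalBasis ℂ V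
  have hcard : ht.toFinset.card < (Finset.univ : Finset (Fin (Module.finrank ℂ V))).card := by
    rwa [Finset.card_fin, hV]
  have hcenter : ∀ i, ∃ y ∈ t, dist (K (b i : S)) y < ε / 2 := fun i => by
    have hmem : K (b i : S) ∈ ⇑K.toLinearMap '' Metric.closedBall 0 1 :=
      ⟨_, mem_closedBall_zero_iff.2 (b.orthonormal.1 i).le, rfl⟩
    simpa using hcov hmem
  choose c hct hc using hcenter
  obtain ⟨i, -, j, -, hij, hcij⟩ := Finset.exists_ne_map_eq_of_card_lt_of_maps_to hcard
    (f := c) fun i _ => by simpa using hct i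
  have hclose : ‖K ((b i - b j : V) : S)‖ < ε := by
    have h := dist_triangle_right (K (b i : S)) (K (b j : S)) (c i)
    have hj := hc j
    rw [← hcij] at hj
    rw [dist_eq_norm, ← map_sub] at h
    exact h.trans_lt (by linarith [hc i])
  have hsep : 1 ≤ ‖b i - b j‖ := by
    have h := @norm_sub_sq ℂ V _ _ _ (b i) (b j)
    rw [b.orthonormal.2 hij, b.orthonormal.1 i, b.orthonormal.1 j] at h
    simp only [map_zero, mul_zero, sub_zero, one_pow] at h
    nlinarith [norm_nonneg (b i - b j)]
  exact absurd ((hS _ ((b i - b j : V) : S).2).trans_lt hclose)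
    (not_lt.2 (le_mul_of_one_le_right hε.le hsep))

/-- An eigenvector of `P K P` for a nonzero eigenvalue is fixed by the idempotent `P`. -/
theorem apply_eq_self_of_comp_apply_eq_smul {P K : H →L[ℂ] H} (hP : P ∘L P = P) {x : H} {μ : ℂ}
    (hμ : μ ≠ 0) (hx : (P ∘L K ∘L P) x = μ • x) : P x = x := by
  have h : P ((P ∘L K ∘L P) x) = (P ∘L K ∘L P) x := DFunLike.congr_fun hP (K (P x))
  rw [hx, map_smul] at h
  exact smul_right_injective H hμ h

end

/-- Projection-uniform spectral clustering in Theorem 3.2(ii): for a compact self-adjoint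
operator `K` and `ε > 0`, there is `M = M(K, ε)` such that for every orthogonal projection
`P`, the span of all eigenvectors of `P K P` with real eigenvalue `μ`, `|μ| ≥ ε`, has
dimension at most `M`. -/
theorem stmt6 {H : Type*} [NormedAddCommGroup H] [InnerProductSpace ℂ H] [CompleteSpace H]
    (K : H →L[ℂ] H) (hK : IsCompactOperator K) (hK_sa : IsSelfAdjoint K)
    (ε : ℝ) (hε : 0 < ε) :
    ∃ M : ℕ, ∀ P : H →L[ℂ] H, P ∘L P = P → IsSelfAdjoint P →
      FiniteDimensional ℂ
        ↥(Submodule.span ℂ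
          {x : H | x ≠ 0 ∧ ∃ μ : ℝ, ε ≤ |μ| ∧ (P ∘L K ∘L P) x = (μ : ℂ) • x}) ∧
      Module.finrank ℂ
        ↥(Submodule.span ℂ
          {x : H | x ≠ 0 ∧ ∃ μ : ℝ, ε ≤ |μ| ∧ (P ∘L K ∘L P) x = (μ : ℂ) • x}) ≤ M := by
  obtain ⟨M, hM⟩ := hK.exists_rank_le hε
  refine ⟨M, fun P hP hP_sa => ?_⟩
  have hT : (P ∘L K ∘L P).toLinearMap.IsSymmetric := by
    intro x y
    have hPs := hP_sa.isSymmetric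
    have hKs := hK_sa.isSymmetric
    exact (hPs (K (P x)) y).trans ((hKs (P x) (P y)).trans (hPs x (K (P y))))
  have hPnorm : ‖P‖ ≤ 1 := IsStarProjection.norm_le P ⟨hP, hP_sa⟩
  have hrank := hM (Submodule.span ℂ
      {x : H | x ≠ 0 ∧ ∃ μ : ℝ, ε ≤ |μ| ∧ (P ∘L K ∘L P) x = (μ : ℂ) • x}) fun x hx => by
    have hPx : P x = x := by
      refine LinearMap.eqOn_span (f := P.toLinearMap) (g := LinearMap.id) ?_ hx
      rintro y ⟨-, μ, hμ, hy⟩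
      exact apply_eq_self_of_comp_apply_eq_smul hP
        (Complex.ofReal_ne_zero.2 (abs_pos.1 (hε.trans_le hμ))) hy
    have hsup : x ∈ ⨆ μ : {μ : ℂ // ε ≤ ‖μ‖},
        Module.End.eigenspace (P ∘L K ∘L P).toLinearMap μ := by
      refine Submodule.span_le.2 ?_ hx
      rintro y ⟨-, μ, hμ, hy⟩
      exact Submodule.mem_iSup_of_mem ⟨(μ : ℂ), by simpa using hμ⟩
        (Module.End.mem_eigenspace_iff.2 hy)
    calc ε * ‖x‖ ≤ ‖P (K (P x))‖ := hT.mul_norm_le_norm_of_mem_iSup_eigenspace hε.le hsup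
      _ ≤ ‖K x‖ := by
        rw [hPx]
        exact P.le_of_opNorm_le hPnorm _ |>.trans_eq (one_mul _)
  exact ⟨Module.rank_lt_aleph0_iff.1 (hrank.trans_lt Cardinal.natCast_lt_aleph0),
    Module.finrank_le_of_rank_le hrank⟩
end

section
/- Let n ≥ 1 and let H_x, H_y, H_z be n × n complex matrices with eigendecompositions H_d = T_d · diag(λ_d) · T_d⁻¹ (T_d invertible, λ_d : Fin n → ℂ) for d ∈ {x, y, z}, and suppose λ_x(i) + λ_y(j) + λ_z(k) ≠ 0 for all indices i, j, k. Then the matrix L = I ⊗ I ⊗ H_x + I ⊗ H_y ⊗ I + H_z ⊗ I ⊗ I is invertible, and L⁻¹ = (T_z ⊗ T_y ⊗ T_x) · D' · (T_z ⊗ T_y ⊗ T_x)⁻¹, where D' is the diagonal matrix with diagonal entries (λ_z(k) + λ_y(j) + λ_x(i))⁻¹. -/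
open Matrix
open scoped Kronecker

/-- A Kronecker product of three simultaneously diagonalized matrices is diagonalized by the
Kronecker product of the diagonalizing matrices. -/
theorem kronecker_conj_diagonal {R l m n : Type*} [CommRing R]
    [Fintype l] [DecidableEq l] [Fintype m] [DecidableEq m] [Fintype n] [DecidableEq n]
    (A : Matrix l l R) (B : Matrix m m R) (C : Matrix n n R)
    (a : l → R) (b : m → R) (c : n → R) :
    (A * Matrix.diagonal a * A⁻¹) ⊗ₖ (B * Matrix.diagonal b * B⁻¹) ⊗ₖ
        (C * Matrix.diagonal c * C⁻¹) =
      (A ⊗ₖ B ⊗ₖ C) * Matrix.diagonal (fun p : (l × m) × n => a p.1.1 * b p.1.2 * c p.2) *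
        (A ⊗ₖ B ⊗ₖ C)⁻¹ := by
  simp only [Matrix.inv_kronecker, Matrix.mul_kronecker_mul, Matrix.diagonal_kronecker_diagonal]

/-- Conjugating an invertible diagonal matrix gives an invertible matrix, whose inverse is the
conjugate of the diagonal matrix of reciprocals. -/
theorem isUnit_and_inv_conj_diagonal {K n : Type*} [Field K] [Fintype n] [DecidableEq n]
    {P : Matrix n n K} (hP : IsUnit P) {d : n → K} (hd : ∀ i, d i ≠ 0) :
    IsUnit (P * Matrix.diagonal d * P⁻¹) ∧
      (P * Matrix.diagonal d * P⁻¹)⁻¹ = P * Matrix.diagonal (fun i => (d i)⁻¹) * P⁻¹ := by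
  have hdet : IsUnit P.det := (Matrix.isUnit_iff_isUnit_det P).mp hP
  have hmul : P * Matrix.diagonal d * P⁻¹ *
      (P * Matrix.diagonal (fun i => (d i)⁻¹) * P⁻¹) = 1 := by
    calc
      _ = P * Matrix.diagonal d * (P⁻¹ * P) * Matrix.diagonal (fun i => (d i)⁻¹) * P⁻¹ := by
        simp only [Matrix.mul_assoc]
      _ = P * (Matrix.diagonal d * Matrix.diagonal (fun i => (d i)⁻¹)) * P⁻¹ := by
        rw [Matrix.nonsing_inv_mul P hdet, Matrix.mul_one, Matrix.mul_assoc P]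
      _ = 1 := by
        simp [Matrix.diagonal_mul_diagonal, hd, Matrix.mul_nonsing_inv P hdet]
  exact ⟨IsUnit.of_mul_eq_one _ hmul, Matrix.inv_eq_right_inv hmul⟩

/-- Correctness of the four-step tensor-product direct solver (Section 2.1): if the
per-axis eigenvalue sums are all nonzero, the Kronecker-sum operator `L` is invertible and
its inverse is obtained by conjugating the diagonal matrix of reciprocal eigenvalue sums
by the Kronecker product of the per-axis eigenvector matrices. -/
theorem stmt10 {n : ℕ} (hn : 1 ≤ n)
    (Hx Hy Hz Tx Ty Tz : Matrix (Fin n) (Fin n) ℂ)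
    (lx ly lz : Fin n → ℂ)
    [Invertible Tx] [Invertible Ty] [Invertible Tz]
    (hx : Hx = Tx * Matrix.diagonal lx * Tx⁻¹)
    (hy : Hy = Ty * Matrix.diagonal ly * Ty⁻¹)
    (hz : Hz = Tz * Matrix.diagonal lz * Tz⁻¹)
    (h0 : ∀ i j k : Fin n, lx i + ly j + lz k ≠ 0) :
    IsUnit ((1 : Matrix (Fin n) (Fin n) ℂ) ⊗ₖ (1 : Matrix (Fin n) (Fin n) ℂ) ⊗ₖ Hx
        + (1 : Matrix (Fin n) (Fin n) ℂ) ⊗ₖ Hy ⊗ₖ (1 : Matrix (Fin n) (Fin n) ℂ)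
        + Hz ⊗ₖ (1 : Matrix (Fin n) (Fin n) ℂ) ⊗ₖ (1 : Matrix (Fin n) (Fin n) ℂ)) ∧
      ((1 : Matrix (Fin n) (Fin n) ℂ) ⊗ₖ (1 : Matrix (Fin n) (Fin n) ℂ) ⊗ₖ Hx
        + (1 : Matrix (Fin n) (Fin n) ℂ) ⊗ₖ Hy ⊗ₖ (1 : Matrix (Fin n) (Fin n) ℂ)
        + Hz ⊗ₖ (1 : Matrix (Fin n) (Fin n) ℂ) ⊗ₖ (1 : Matrix (Fin n) (Fin n) ℂ))⁻¹
      = (Tz ⊗ₖ Ty ⊗ₖ Tx) *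
          Matrix.diagonal
            (fun p : (Fin n × Fin n) × Fin n => (lz p.1.1 + ly p.1.2 + lx p.2)⁻¹) *
          (Tz ⊗ₖ Ty ⊗ₖ Tx)⁻¹ := by
  have hone : ∀ (T : Matrix (Fin n) (Fin n) ℂ) [Invertible T],
      (1 : Matrix (Fin n) (Fin n) ℂ) = T * Matrix.diagonal (fun _ => 1) * T⁻¹ := by
    intro T _
    simp
  have hx' := kronecker_conj_diagonal Tz Ty Tx (fun _ => 1) (fun _ => 1) lx
  have hy' := kronecker_conj_diagonal Tz Ty Tx (fun _ => 1) ly (fun _ => 1)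
  have hz' := kronecker_conj_diagonal Tz Ty Tx lz (fun _ => 1) (fun _ => 1)
  rw [← hone Tz, ← hone Ty, ← hx] at hx'
  rw [← hone Tz, ← hone Tx, ← hy] at hy'
  rw [← hone Ty, ← hone Tx, ← hz] at hz'
  have hP : IsUnit (Tz ⊗ₖ Ty ⊗ₖ Tx) := by
    rw [Matrix.isUnit_iff_isUnit_det, Matrix.det_kronecker, Matrix.det_kronecker]
    have hdet : ∀ (T : Matrix (Fin n) (Fin n) ℂ) [Invertible T], IsUnit T.det :=
      fun T _ => Matrix.isUnit_det_of_invertible T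
    exact ((((hdet Tz).pow _).mul ((hdet Ty).pow _)).pow _).mul ((hdet Tx).pow _)
  have hd : ∀ p : (Fin n × Fin n) × Fin n, lz p.1.1 + ly p.1.2 + lx p.2 ≠ 0 := fun p h =>
    h0 p.2 p.1.2 p.1.1 (by rw [← h]; ring)
  have hsum : (fun p : (Fin n × Fin n) × Fin n =>
      1 * 1 * lx p.2 + 1 * ly p.1.2 * 1 + lz p.1.1 * 1 * 1) =
      fun p => lz p.1.1 + ly p.1.2 + lx p.2 := by
    funext p
    ring
  rw [hx', hy', hz', ← Matrix.add_mul, ← Matrix.mul_add, ← Matrix.add_mul, ← Matrix.mul_add,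
    Matrix.diagonal_add, Matrix.diagonal_add, hsum]
  exact isUnit_and_inv_conj_diagonal hP hd
end
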